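/- Let μ be a probability measure on Aff(P) with finite first moment such that the semigroup generated by the support of μ is all of Aff(P), and suppose φ_p ≠ 0 for some p ∈ P̄. Then there exists a non-constant bounded μ-harmonic function on Aff(P). -/

import Mathlib

/-!
Formalization of statements from "Poisson boundary for finitely generated groups of
rational affinities" (S. Brofferio).

The finite nonempty set `P` of prime numbers is represented as the image of an
injective map `pr : ι → ℕ` (with `[∀ i, Fact (pr i).Prime]`) from a finite nonempty
index type `ι`.  The set `P̄ = P ∪ {∞}` is represented by `Option ι`, with `none`
standing for `∞`.
-/

open MeasureTheory ProbabilityTheory Filter Topology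
open scoped BigOperators

/-- `Z(P)`: the additive subgroup of `ℚ` of rationals of the form
`h * ∏_{p ∈ P} p^{h_p}` with `h, h_p ∈ ℤ`. -/
def ZP {ι : Type} [Fintype ι] (pr : ι → ℕ) : Set ℚ :=
  {q : ℚ | ∃ (h : ℤ) (k : ι → ℤ), q = (h : ℚ) * ∏ i, (pr i : ℚ) ^ (k i)}

/-- `(P)`: the multiplicative subgroup of `ℚ*` of numbers `± ∏_{p ∈ P} p^{k_p}`. -/
def MP {ι : Type} [Fintype ι] (pr : ι → ℕ) : Set ℚ :=
  {a : ℚ | ∃ (s : ℚ) (k : ι → ℤ), (s = 1 ∨ s = -1) ∧ a = s * ∏ i, (pr i : ℚ) ^ (k i)}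

/-- `Aff(P) = (P) ⋉ Z(P)`, as the set of pairs `(a, b)` in `ℚ × ℚ`. -/
def AffSet {ι : Type} [Fintype ι] (pr : ι → ℕ) : Set (ℚ × ℚ) :=
  {g : ℚ × ℚ | g.1 ∈ MP pr ∧ g.2 ∈ ZP pr}

/-- Multiplication in `Aff(P)`: `(a,b)(a',b') = (aa', ab' + b)`. -/
def affMul (g h : ℚ × ℚ) : ℚ × ℚ := (g.1 * h.1, g.1 * h.2 + g.2)

/-- The `p`-adic absolute value `|q|_p` of a rational number, as a real number. -/
noncomputable def ratAbs (p : ℕ) (q : ℚ) : ℝ := ((padicNorm p q : ℚ) : ℝ)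

/-- `ln⁺ t = max (ln t) 0`. -/
noncomputable def logPlus (t : ℝ) : ℝ := max (Real.log t) 0

/-- `μ` has a finite first (logarithmic) moment:
`∫ ∑_{p∈P} |ln |a|_p| dμ(a,b) < ∞` and `∫ ∑_{p∈P̄} ln⁺ |b|_p dμ(a,b) < ∞`. -/
def FirstMoment {ι : Type} [Fintype ι] (pr : ι → ℕ) (μ : Measure (ℚ × ℚ)) : Prop :=
  Integrable (fun g : ℚ × ℚ => ∑ i, |Real.log (ratAbs (pr i) g.1)|) μ ∧
  Integrable (fun g : ℚ × ℚ =>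
    (∑ i, logPlus (ratAbs (pr i) g.2)) + logPlus |(g.2 : ℝ)|) μ

/-- The `p`-drift `φ_p = ∫ ln |a|_p dμ(a,b)` for `p ∈ P`. -/
noncomputable def drift {ι : Type} (pr : ι → ℕ) (μ : Measure (ℚ × ℚ)) (i : ι) : ℝ :=
  ∫ g : ℚ × ℚ, Real.log (ratAbs (pr i) g.1) ∂μ

/-- The drift at `p = ∞`: `φ_∞ = ∫ ln |a|_∞ dμ(a,b)`. -/
noncomputable def driftInf (μ : Measure (ℚ × ℚ)) : ℝ :=
  ∫ g : ℚ × ℚ, Real.log |(g.1 : ℝ)| ∂μ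

/-- `A_n = a_1 ⋯ a_n`, where `X (k-1) = (a_k, b_k)` are the i.i.d. increments. -/
def RA {Ω : Type} (X : ℕ → Ω → ℚ × ℚ) (n : ℕ) (ω : Ω) : ℚ :=
  ∏ k ∈ Finset.range n, (X k ω).1

/-- `Z_n = ∑_{k=1}^n a_1 ⋯ a_{k-1} b_k` (the partial sums of the series `Z_∞`). -/
def RZ {Ω : Type} (X : ℕ → Ω → ℚ × ℚ) (n : ℕ) (ω : Ω) : ℚ :=
  ∑ k ∈ Finset.range n, (∏ j ∈ Finset.range k, (X j ω).1) * (X k ω).2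

/-- The sequence `ω` preceded by `x`. -/
def prepend {X : Type*} (x : X) (ω : ℕ → X) : ℕ → X
  | 0 => x
  | n + 1 => ω n

lemma measurable_prepend {X : Type*} [MeasurableSpace X] :
    Measurable (fun x : X × (ℕ → X) => prepend x.1 x.2) := by
  refine measurable_pi_lambda _ fun n => ?_
  cases n
  · exact measurable_fst
  · exact (measurable_pi_apply _).comp measurable_snd

/-- Prepending an independent sample of law `μ` to an i.i.d. sequence of law `μ` yields an
i.i.d. sequence of law `μ`. -/
lemma map_prepend_prod_infinitePi {X : Type*} [MeasurableSpace X] (μ : Measure X)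
    [IsProbabilityMeasure μ] :
    (μ.prod (Measure.infinitePi fun _ : ℕ => μ)).map
      (fun x : X × (ℕ → X) => prepend x.1 x.2) =
      Measure.infinitePi fun _ : ℕ => μ := by
  classical
  refine Measure.eq_infinitePi _ fun s t ht => ?_
  rw [Measure.map_apply measurable_prepend (.pi s.countable_toSet fun i _ => ht i)]
  set s' : Finset ℕ := s.preimage Nat.succ Nat.succ_injective.injOn with hs'
  have hpre : (fun x : X × (ℕ → X) => prepend x.1 x.2) ⁻¹' (Set.pi s t) =
      (if 0 ∈ s then t 0 else Set.univ) ×ˢ Set.pi s' fun n => t (n + 1) := by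
    ext ⟨h, ω⟩
    have hcases : ∀ p : ℕ → Prop, (∀ n, p n) ↔ p 0 ∧ ∀ n, p (n + 1) := fun p =>
      ⟨fun hp => ⟨hp 0, fun n => hp _⟩, fun hp n => Nat.casesOn n hp.1 hp.2⟩
    simp only [Set.mem_preimage, Set.mem_pi, Finset.mem_coe, Set.mem_prod, hs',
      Finset.mem_preimage]
    rw [hcases]
    split_ifs with h0 <;> simp [h0, prepend]
  rw [hpre, Measure.prod_prod, Measure.infinitePi_pi _ fun i _ => ht _]
  have hprod : ∏ i ∈ s', μ (t (i + 1)) = ∏ i ∈ s.erase 0, μ (t i) := by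
    have : s.erase 0 = s'.map ⟨Nat.succ, Nat.succ_injective⟩ := by
      ext n
      cases n <;> simp [hs']
    rw [this, Finset.prod_map]
    rfl
  rw [hprod]
  split_ifs with h0
  · exact Finset.mul_prod_erase s (fun i => μ (t i)) h0
  · rw [measure_univ, one_mul, Finset.erase_eq_of_notMem h0]

lemma RZ_succ_prepend (h : ℚ × ℚ) (ω : ℕ → ℚ × ℚ) (n : ℕ) :
    RZ (fun k (ω : ℕ → ℚ × ℚ) => ω k) (n + 1) (prepend h ω) =
      h.1 * RZ (fun k (ω : ℕ → ℚ × ℚ) => ω k) n ω + h.2 := by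
  simp [RZ, prepend, Finset.sum_range_succ', Finset.prod_range_succ', Finset.mul_sum, mul_comm,
    mul_left_comm]

lemma measurable_RZ (n : ℕ) : Measurable (RZ (fun k (ω : ℕ → ℚ × ℚ) => ω k) n) := by
  unfold RZ
  fun_prop

/-- The event that the walk started at `g` eventually stays in the ball of radius `R`. -/
def eventuallyBall (N : AbsoluteValue ℚ ℝ) (R : ℝ) (g : ℚ × ℚ) : Set (ℕ → ℚ × ℚ) :=
  {ω | ∀ᶠ n in atTop, N (g.1 * RZ (fun k (ω : ℕ → ℚ × ℚ) => ω k) n ω + g.2) ≤ R}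

lemma measurableSet_eventuallyBall (N : AbsoluteValue ℚ ℝ) (R : ℝ) (g : ℚ × ℚ) :
    MeasurableSet (eventuallyBall N R g) := by
  simp only [eventuallyBall, eventually_atTop]
  refine measurableSet_setOfPred.2 (.exists fun m => .forall fun n => .imp (by simp) ?_)
  exact measurableSet_setOfPred.1 <|
    measurable_RZ n (MeasurableSet.of_discrete (s := {z : ℚ | N (g.1 * z + g.2) ≤ R}))

lemma prepend_mem_eventuallyBall (N : AbsoluteValue ℚ ℝ) (R : ℝ) (g h : ℚ × ℚ)
    (ω : ℕ → ℚ × ℚ) :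
    prepend h ω ∈ eventuallyBall N R g ↔
      ω ∈ eventuallyBall N R (affMul g h) := by
  change (∀ᶠ n in atTop, N (g.1 * RZ _ n _ + g.2) ≤ R) ↔
    ∀ᶠ n in atTop, N ((affMul g h).1 * RZ _ n ω + (affMul g h).2) ≤ R
  conv_lhs => rw [← map_add_atTop_eq_nat 1, eventually_map]
  simp only [RZ_succ_prepend, affMul, mul_add, mul_assoc, add_assoc]

/-- The probability that the walk started at `g` eventually stays in a ball is harmonic. -/
lemma measureReal_eventuallyBall_harmonic (μ : Measure (ℚ × ℚ)) [IsProbabilityMeasure μ]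
    (N : AbsoluteValue ℚ ℝ) (R : ℝ) (g : ℚ × ℚ) :
    (Measure.infinitePi fun _ : ℕ => μ).real (eventuallyBall N R g) =
      ∫ h, (Measure.infinitePi fun _ : ℕ => μ).real (eventuallyBall N R (affMul g h)) ∂μ := by
  have hE := measurableSet_eventuallyBall N R g
  conv_lhs => rw [measureReal_def, ← map_prepend_prod_infinitePi μ,
    Measure.map_apply measurable_prepend hE,
    Measure.prod_apply (measurable_prepend hE)]
  simp only [measureReal_def]
  rw [integral_toReal Measurable.of_discrete.aemeasurable (by simp)]
  congr 2 with h
  congr 1 with ω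
  exact prepend_mem_eventuallyBall N R g h ω

/-- The strong law of large numbers on the canonical sequence space. -/
lemma ae_tendsto_average (μ : Measure (ℚ × ℚ)) [IsProbabilityMeasure μ] {F : ℚ × ℚ → ℝ}
    (hF : Integrable F μ) :
    ∀ᵐ ω ∂Measure.infinitePi fun _ : ℕ => μ,
      Tendsto (fun n : ℕ => (∑ i ∈ Finset.range n, F (ω i)) / n) atTop (𝓝 (∫ g, F g ∂μ)) := by
  have hFm : Measurable F := .of_discrete
  have hev (i : ℕ) : Measurable fun ω : ℕ → ℚ × ℚ => ω i := measurable_pi_apply i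
  have hident (i : ℕ) : (Measure.infinitePi fun _ : ℕ => μ).map (fun ω => ω i) = μ :=
    Measure.infinitePi_map_eval _ i
  have key := strong_law_ae_real (μ := Measure.infinitePi fun _ : ℕ => μ)
    (fun i ω => F (ω i)) ((measurePreserving_eval_infinitePi (fun _ : ℕ => μ) 0).integrable_comp
      hF.aestronglyMeasurable |>.2 hF)
    (fun i j hij => (iIndepFun_infinitePi (P := fun _ : ℕ => μ) (X := fun _ => F)
      fun _ => hFm).indepFun hij)
    (fun i => ⟨(hFm.comp (hev i)).aemeasurable, (hFm.comp (hev 0)).aemeasurable, by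
      refine (Measure.map_map hFm (hev i)).symm.trans (.trans ?_ (Measure.map_map hFm (hev 0)))
      rw [hident, hident]⟩)
  have hint : ∫ ω, F (ω 0) ∂(Measure.infinitePi fun _ : ℕ => μ) = ∫ g, F g ∂μ := by
    conv_rhs => rw [← hident 0]
    rw [integral_map (hev 0).aemeasurable hFm.aestronglyMeasurable]
  rwa [hint] at key

lemma le_exp_logPlus (t : ℝ) : t ≤ Real.exp (logPlus t) :=
  (Real.le_exp_log t).trans (Real.exp_le_exp.2 (le_max_left _ _))

lemma exists_bound_RZ (N : AbsoluteValue ℚ ℝ) (ω : ℕ → ℚ × ℚ) {c d : ℝ} (hc : c < 0)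
    (hne : ∀ i, (ω i).1 ≠ 0)
    (ha : Tendsto (fun n : ℕ => (∑ i ∈ Finset.range n, Real.log (N (ω i).1)) / n) atTop (𝓝 c))
    (hb : Tendsto (fun n : ℕ => (∑ i ∈ Finset.range n, logPlus (N (ω i).2)) / n) atTop (𝓝 d)) :
    ∃ C, ∀ n, N (RZ (fun k (ω : ℕ → ℚ × ℚ) => ω k) n ω) ≤ C := by
  have hlast : Tendsto (fun n : ℕ => logPlus (N (ω n).2) / n) atTop (𝓝 0) := by
    have h1 := (tendsto_add_atTop_iff_nat 1).2 hb
    have h2 : Tendsto (fun n : ℕ => ((n + 1 : ℕ) : ℝ) / n) atTop (𝓝 1) := by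
      have := tendsto_one_div_atTop_nhds_zero_nat (𝕜 := ℝ) |>.const_add 1
      rw [add_zero] at this
      refine this.congr' ?_
      filter_upwards [eventually_gt_atTop 0] with n hn
      have : (n : ℝ) ≠ 0 := by positivity
      push_cast
      field_simp
    have h3 := (h1.mul h2).sub hb
    rw [mul_one, sub_self] at h3
    refine h3.congr' ?_
    filter_upwards [eventually_gt_atTop 0] with n hn
    have : (n : ℝ) ≠ 0 := by positivity
    have : ((n + 1 : ℕ) : ℝ) ≠ 0 := by positivity
    rw [Finset.sum_range_succ]
    field_simp
    ring
  have hterm : ∀ᶠ n : ℕ in atTop,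
      N ((∏ j ∈ Finset.range n, (ω j).1) * (ω n).2) ≤ Real.exp (c / 2) ^ n := by
    have hsum := ha.add hlast
    rw [add_zero] at hsum
    filter_upwards [hsum.eventually_lt_const (show c < c / 2 by linarith),
      eventually_gt_atTop 0] with n hn hn0
    have hn0' : (0 : ℝ) < n := by positivity
    rw [← add_div, div_lt_iff₀ hn0'] at hn
    calc N ((∏ j ∈ Finset.range n, (ω j).1) * (ω n).2)
        = Real.exp (∑ i ∈ Finset.range n, Real.log (N (ω i).1)) * N (ω n).2 := by
          rw [map_mul, map_prod, Real.exp_sum]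
          congr 1
          exact Finset.prod_congr rfl fun i _ => (Real.exp_log (N.pos (hne i))).symm
      _ ≤ Real.exp (∑ i ∈ Finset.range n, Real.log (N (ω i).1)) *
            Real.exp (logPlus (N (ω n).2)) := by
          gcongr
          exact le_exp_logPlus _
      _ ≤ Real.exp (c / 2) ^ n := by
          rw [← Real.exp_add, ← Real.exp_nat_mul]
          exact Real.exp_le_exp.2 (by linarith)
  have hsummable : Summable fun n : ℕ => N ((∏ j ∈ Finset.range n, (ω j).1) * (ω n).2) := by
    refine Summable.of_norm_bounded_eventually_nat
      (summable_geometric_of_lt_one (Real.exp_pos (c / 2)).le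
        (Real.exp_lt_one_iff.2 (by linarith))) ?_
    filter_upwards [hterm] with n hn
    rwa [Real.norm_of_nonneg (N.nonneg _)]
  exact ⟨_, fun n => (N.sum_le _ _).trans
    (hsummable.sum_le_tsum _ fun i _ => N.nonneg _)⟩

/-- If the linear parts contract in mean for the absolute value `N` and `N` is unbounded on
the translations in `S`, then some bounded harmonic function is not constant on `S`. -/
lemma exists_harmonic_of_contracting (μ : Measure (ℚ × ℚ)) [IsProbabilityMeasure μ]
    (N : AbsoluteValue ℚ ℝ) (S : Set (ℚ × ℚ)) (hS : ∀ R, ∃ b, ((1, b) : ℚ × ℚ) ∈ S ∧ R < N b)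
    (hS1 : ((1, 0) : ℚ × ℚ) ∈ S) (hne : ∀ᵐ g ∂μ, g.1 ≠ 0)
    (ha : Integrable (fun g => Real.log (N g.1)) μ) (hneg : ∫ g, Real.log (N g.1) ∂μ < 0)
    (hb : Integrable (fun g => logPlus (N g.2)) μ) :
    ∃ f : ℚ × ℚ → ℝ, (∃ C : ℝ, ∀ g ∈ S, |f g| ≤ C) ∧
      (∀ g ∈ S, f g = ∫ h, f (affMul g h) ∂μ) ∧
      ∃ g ∈ S, ∃ g' ∈ S, f g ≠ f g' := by
  set Q := Measure.infinitePi fun _ : ℕ => μ with hQ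
  have hbdd : ∀ᵐ ω ∂Q, ∃ C, ∀ n, N (RZ (fun k (ω : ℕ → ℚ × ℚ) => ω k) n ω) ≤ C := by
    have hne' : ∀ᵐ ω ∂Q, ∀ i, (ω i).1 ≠ 0 := ae_all_iff.2 fun i =>
      (measurePreserving_eval_infinitePi (fun _ : ℕ => μ) i).quasiMeasurePreserving.ae hne
    filter_upwards [hne', ae_tendsto_average μ ha, ae_tendsto_average μ hb] with ω h1 h2 h3
    exact exists_bound_RZ N ω hneg h1 h2 h3
  let D : ℕ → Set (ℕ → ℚ × ℚ) :=
    fun m => {ω | ∀ n, N (RZ (fun k (ω : ℕ → ℚ × ℚ) => ω k) n ω) ≤ m}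
  have hDmono : Monotone D := fun m m' hm ω hω n => (hω n).trans (by exact_mod_cast hm)
  have hDmeas (m : ℕ) : MeasurableSet (D m) :=
    measurableSet_setOfPred.2 <| .forall fun n => measurableSet_setOfPred.1 <|
      measurable_RZ n (MeasurableSet.of_discrete (s := {z : ℚ | N z ≤ m}))
  have hDunion : Q (⋃ m, D m) = 1 := by
    rw [← mem_ae_iff_prob_eq_one (.iUnion hDmeas)]
    filter_upwards [hbdd] with ω ⟨C, hC⟩
    obtain ⟨m, hm⟩ := exists_nat_ge C
    exact Set.mem_iUnion.2 ⟨m, fun n => (hC n).trans hm⟩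
  obtain ⟨m, hm⟩ : ∃ m, 1 / 2 < Q.real (D m) := by
    have hlim := tendsto_measure_iUnion_atTop (μ := Q) hDmono
    rw [hDunion] at hlim
    have hlim' := (ENNReal.tendsto_toReal ENNReal.one_ne_top).comp hlim
    rw [ENNReal.toReal_one] at hlim'
    exact (hlim'.eventually_const_lt (by norm_num)).exists
  have hhalf : 1 / 2 < Q.real (eventuallyBall N m (1, 0)) :=
    hm.trans_le (measureReal_mono fun ω hω => .of_forall fun n => by simpa using hω n)
  obtain ⟨b, hbS, hbm⟩ := hS (2 * m)
  have hdisj : Disjoint (eventuallyBall N m (1, 0)) (eventuallyBall N m (1, b)) := by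
    rw [Set.disjoint_left]
    intro ω h1 h2
    obtain ⟨n, h1, h2⟩ := (h1.and h2).exists
    simp only [one_mul, add_zero] at h1 h2
    have := N.le_sub b (-RZ (fun k (ω : ℕ → ℚ × ℚ) => ω k) n ω)
    rw [N.map_neg, sub_neg_eq_add, add_comm b] at this
    linarith
  refine ⟨fun g => Q.real (eventuallyBall N m g), ⟨1, fun g _ => ?_⟩,
    fun g _ => measureReal_eventuallyBall_harmonic μ N m g, (1, 0), hS1, (1, b), hbS, fun h => ?_⟩
  · rw [abs_of_nonneg measureReal_nonneg]
    exact measureReal_le_one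
  · have hle : Q.real (eventuallyBall N m (1, 0) ∪ eventuallyBall N m (1, b)) ≤ 1 :=
      measureReal_le_one
    rw [measureReal_union hdisj (measurableSet_eventuallyBall N m _)] at hle
    simp only at h
    linarith

lemma ne_zero_of_mem_MP {ι : Type} [Fintype ι] (pr : ι → ℕ) [∀ i, Fact (pr i).Prime] {a : ℚ}
    (ha : a ∈ MP pr) : a ≠ 0 := by
  obtain ⟨s, k, hs, rfl⟩ := ha
  refine mul_ne_zero (by rcases hs with rfl | rfl <;> norm_num)
    (Finset.prod_ne_zero_iff.2 fun i _ => zpow_ne_zero _ ?_)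
  exact_mod_cast (Fact.out : (pr i).Prime).ne_zero

lemma log_absoluteValue_sign_mul_prod_zpow {ι : Type} [Fintype ι] (pr : ι → ℕ)
    [∀ i, Fact (pr i).Prime] (N : AbsoluteValue ℚ ℝ) {s : ℚ} (hs : s = 1 ∨ s = -1) (k : ι → ℤ) :
    Real.log (N (s * ∏ i, (pr i : ℚ) ^ k i)) = ∑ i, k i * Real.log (N (pr i)) := by
  have hs' : N s = 1 := by rcases hs with rfl | rfl <;> simp
  rw [map_mul, hs', one_mul, map_prod, Real.log_prod]
  · simp
  · intro i _
    rw [map_zpow₀]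
    exact zpow_ne_zero _ (N.ne_zero (by exact_mod_cast (Fact.out : (pr i).Prime).ne_zero))

/-- The product formula on `(P)`, in logarithmic form. -/
lemma log_abs_eq_neg_sum_of_mem_MP {ι : Type} [Fintype ι] (pr : ι → ℕ)
    [∀ i, Fact (pr i).Prime] (hinj : Function.Injective pr) {a : ℚ} (ha : a ∈ MP pr) :
    Real.log |(a : ℝ)| = -∑ i, Real.log (ratAbs (pr i) a) := by
  classical
  obtain ⟨s, k, hs, rfl⟩ := ha
  have hp (j : ι) : Real.log (ratAbs (pr j) (s * ∏ i, (pr i : ℚ) ^ k i)) =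
      -(k j * Real.log (pr j)) := by
    refine (log_absoluteValue_sign_mul_prod_zpow pr (Rat.AbsoluteValue.padic (pr j)) hs k).trans ?_
    rw [Finset.sum_eq_single j]
    · simp [padicNorm.padicNorm_p_of_prime]
    · intro i _ hij
      have : ¬ pr j ∣ pr i := fun h => hij
        (hinj ((Nat.prime_dvd_prime_iff_eq Fact.out Fact.out).1 h).symm)
      simp [(padicNorm.nat_eq_one_iff (p := pr j) (pr i)).2 this]
    · simp
  have hr := log_absoluteValue_sign_mul_prod_zpow pr Rat.AbsoluteValue.real hs k
  simp only [Rat.AbsoluteValue.real_eq_abs] at hr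
  simp only [hp, Finset.sum_neg_distrib, neg_neg]
  rw [← Rat.cast_abs, hr]
  simp

lemma one_mem_MP {ι : Type} [Fintype ι] (pr : ι → ℕ) : (1 : ℚ) ∈ MP pr :=
  ⟨1, 0, .inl rfl, by simp⟩

lemma intCast_mem_ZP {ι : Type} [Fintype ι] (pr : ι → ℕ) (h : ℤ) : (h : ℚ) ∈ ZP pr :=
  ⟨h, 0, by simp⟩

lemma zpow_mem_ZP {ι : Type} [Fintype ι] (pr : ι → ℕ) (i : ι) (n : ℤ) :
    (pr i : ℚ) ^ n ∈ ZP pr := by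
  classical
  exact ⟨1, Pi.single i n, by
    rw [Finset.prod_eq_single i (fun j _ hj => by simp [hj]) (by simp)]; simp⟩

lemma logPlus_nonneg (t : ℝ) : 0 ≤ logPlus t := le_max_right _ _

/-- Let `μ` be a probability measure on `Aff(P)` with finite first
moment whose support generates `Aff(P)` as a semigroup, and suppose `φ_p ≠ 0` for
some `p ∈ P̄`.  Then there exists a non-constant bounded `μ`-harmonic function on
`Aff(P)`. -/
theorem exists_nonconstant_harmonic_of_nonzero_drift
    (ι : Type) [Fintype ι] [Nonempty ι] (pr : ι → ℕ) [∀ i, Fact (pr i).Prime]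
    (hinj : Function.Injective pr)
    (μ : Measure (ℚ × ℚ)) [IsProbabilityMeasure μ] (hAff : μ (AffSet pr) = 1)
    (hmom : FirstMoment pr μ)
    (hgen : ∀ T : Set (ℚ × ℚ), {g : ℚ × ℚ | μ {g} ≠ 0} ⊆ T →
      (∀ g ∈ T, ∀ h ∈ T, affMul g h ∈ T) → AffSet pr ⊆ T)
    (hdrift : driftInf μ ≠ 0 ∨ ∃ i, drift pr μ i ≠ 0) :
    ∃ f : ℚ × ℚ → ℝ, (∃ C : ℝ, ∀ g ∈ AffSet pr, |f g| ≤ C) ∧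
      (∀ g ∈ AffSet pr, f g = ∫ h, f (affMul g h) ∂μ) ∧
      ∃ g ∈ AffSet pr, ∃ g' ∈ AffSet pr, f g ≠ f g' := by
  have hae : ∀ᵐ g ∂μ, g ∈ AffSet pr := (mem_ae_iff_prob_eq_one .of_discrete).2 hAff
  have hne : ∀ᵐ g ∂μ, g.1 ≠ 0 := hae.mono fun g hg => ne_zero_of_mem_MP pr hg.1
  have hid : ((1, 0) : ℚ × ℚ) ∈ AffSet pr :=
    ⟨one_mem_MP pr, by simpa using intCast_mem_ZP pr 0⟩
  have hlog (i : ι) : Integrable (fun g : ℚ × ℚ => Real.log (ratAbs (pr i) g.1)) μ := by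
    refine hmom.1.mono' Measurable.of_discrete.aestronglyMeasurable (.of_forall fun g => ?_)
    exact Finset.single_le_sum (f := fun i => |Real.log (ratAbs (pr i) g.1)|)
      (fun _ _ => abs_nonneg _) (Finset.mem_univ i)
  have hlogInf : ∀ᵐ g ∂μ, Real.log |(g.1 : ℝ)| = -∑ i, Real.log (ratAbs (pr i) g.1) :=
    hae.mono fun g hg => log_abs_eq_neg_sum_of_mem_MP pr hinj hg.1
  have hsum : driftInf μ = -∑ i, drift pr μ i := by
    rw [driftInf, integral_congr_ae hlogInf, integral_neg,
      integral_finsetSum _ fun i _ => hlog i]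
    rfl
  have hneg : driftInf μ < 0 ∨ ∃ i, drift pr μ i < 0 := by
    by_contra! hnn
    have hzero : ∑ i, drift pr μ i = 0 :=
      le_antisymm (by linarith [hnn.1]) (Finset.sum_nonneg fun i _ => hnn.2 i)
    rcases hdrift with h | ⟨i, hi⟩
    · exact h (by rw [hsum, hzero, neg_zero])
    · exact hi ((Finset.sum_eq_zero_iff_of_nonneg fun i _ => hnn.2 i).1 hzero i
        (Finset.mem_univ i))
  rcases hneg with hneg | ⟨i, hneg⟩
  · refine exists_harmonic_of_contracting μ Rat.AbsoluteValue.real _ (fun R => ?_) hid hne ?_ ?_ ?_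
    · obtain ⟨n, hn⟩ := exists_nat_gt R
      exact ⟨n, ⟨one_mem_MP pr, by simpa using intCast_mem_ZP pr n⟩, by simpa using hn⟩
    · simpa using ((integrable_finsetSum _ fun i _ => hlog i).neg).congr
        (hlogInf.mono fun g hg => hg.symm)
    · simpa [driftInf] using hneg
    · refine hmom.2.mono' Measurable.of_discrete.aestronglyMeasurable (.of_forall fun g => ?_)
      rw [Real.norm_of_nonneg (logPlus_nonneg _)]
      simpa using Finset.sum_nonneg fun i _ => logPlus_nonneg (ratAbs (pr i) g.2)
  · refine exists_harmonic_of_contracting μ (Rat.AbsoluteValue.padic (pr i)) _ (fun R => ?_) hid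
      hne (hlog i) hneg ?_
    · have hp : (1 : ℝ) < pr i := by exact_mod_cast (Fact.out : (pr i).Prime).one_lt
      obtain ⟨n, hn⟩ := pow_unbounded_of_one_lt R hp
      exact ⟨_, ⟨one_mem_MP pr, zpow_mem_ZP pr i (-n)⟩, by
        rw [map_zpow₀]; simpa [padicNorm.padicNorm_p_of_prime] using hn⟩
    · refine hmom.2.mono' Measurable.of_discrete.aestronglyMeasurable (.of_forall fun g => ?_)
      rw [Real.norm_of_nonneg (logPlus_nonneg _)]
      exact (Finset.single_le_sum (f := fun i => logPlus (ratAbs (pr i) g.2))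
        (fun _ _ => logPlus_nonneg _) (Finset.mem_univ i)).trans
        (le_add_of_nonneg_right (logPlus_nonneg _))
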